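/- Let G be a finite simple connected unicyclic graph that is not a cycle, with unique cycle C(G). If there exists a doubly resolving set B for the cycle C(G) of minimum cardinality (a doubly basis of C(G)) all of whose vertices have degree at least 3 in G, then ψ(G) = l(G). -/

import Mathlib

open SimpleGraph

/-- Vertices `u, v` are doubly resolved by vertices `x, y` if
`d(u,x) − d(v,x) ≠ d(u,y) − d(v,y)`. -/
def doublyResolves {V : Type*} (G : SimpleGraph V) (x y u v : V) : Prop :=
  (G.dist u x : ℤ) - (G.dist v x : ℤ) ≠ (G.dist u y : ℤ) - (G.dist v y : ℤ)

/-- A set `W` of vertices is a doubly resolving set for `G` if every two distinct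
vertices of `G` are doubly resolved by some two vertices of `W`. -/
def IsDoublyResolvingSet {V : Type*} (G : SimpleGraph V) (W : Set V) : Prop :=
  ∀ u v : V, u ≠ v → ∃ x ∈ W, ∃ y ∈ W, doublyResolves G x y u v

/-- The doubly resolving number `ψ(G)`: the minimum cardinality of a doubly
resolving set for `G`. -/
noncomputable def psi {V : Type*} (G : SimpleGraph V) : ℕ :=
  sInf {k | ∃ W : Finset V, W.card = k ∧ IsDoublyResolvingSet G ↑W}


section Helpers

variable {V : Type*} [Fintype V] [DecidableEq V] {G : SimpleGraph V}

/-- A chord of a cycle would give a cycle with smaller support. -/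
lemma chordless_aux {u v : V} (c : G.Walk u u) (hc : c.IsCycle)
    (huniq : ∀ (u : V) (c' : G.Walk u u), c'.IsCycle →
      c'.support.toFinset = c.support.toFinset)
    (hv : v ∈ c.support) (h : G.Adj u v) : s(u, v) ∈ c.edges := by
  by_contra hne
  have hp := hc.isPath_takeUntil hv
  have hcyc : (Walk.cons h.symm (c.takeUntil v hv)).IsCycle := by
    rw [Walk.cons_isCycle_iff]
    refine ⟨hp, fun h' => hne ?_⟩
    rw [Sym2.eq_swap]
    exact c.edges_takeUntil_subset_edges hv h'
  have h1 := congrArg Finset.card (huniq _ _ hcyc)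
  have h2 : (Walk.cons h.symm (c.takeUntil v hv)).support.toFinset
      = (c.takeUntil v hv).support.toFinset := by
    ext x
    simp only [Walk.support_cons, List.mem_toFinset, List.mem_cons]
    constructor
    · rintro (rfl | h)
      · simp
      · exact h
    · exact Or.inr
  have h3 : (c.takeUntil v hv).support.toFinset.card = (c.takeUntil v hv).length + 1 := by
    rw [List.toFinset_card_of_nodup hp.support_nodup, Walk.length_support]
  have h4 : c.support.toFinset.card = c.length := by
    have : c.support.toFinset = c.support.tail.toFinset := by
      ext x
      simp only [List.mem_toFinset]
      constructor
      · intro hx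
        rcases (c.mem_support_iff).1 hx with rfl | hx
        · exact Walk.end_mem_tail_support hc.not_nil
        · exact hx
      · exact List.mem_of_mem_tail
    rw [this, List.toFinset_card_of_nodup hc.support_nodup]
    simp
  have h5 := congrArg Walk.length (c.take_spec hv)
  rw [Walk.length_append] at h5
  rw [h2, h3, h4] at h1
  have h6 : (c.dropUntil v hv).length = 1 := by omega
  apply hne
  apply c.edges_dropUntil_subset_edges hv
  rw [Sym2.eq_swap]
  generalize c.dropUntil v hv = q at h6
  cases q with
  | nil => simp at h6
  | cons a q =>
    cases q with
    | nil => simp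
    | cons b q => simp at h6

lemma chordless {v₀ u v : V} (c : G.Walk v₀ v₀) (hc : c.IsCycle)
    (huniq : ∀ (u : V) (c' : G.Walk u u), c'.IsCycle →
      c'.support.toFinset = c.support.toFinset)
    (hu : u ∈ c.support) (hv : v ∈ c.support) (h : G.Adj u v) : c.toSubgraph.Adj u v := by
  have := chordless_aux (c.rotate u hu) (hc.rotate hu)
    (fun w c' hc' => by
      rw [huniq w c' hc']
      ext x
      simp) (v := v) (by simpa using hv) h
  rw [Walk.adj_toSubgraph_iff_mem_edges]
  exact (c.rotate_edges u hu).perm.mem_iff.1 this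

/-- Every edge with an endpoint outside the cycle is a bridge. -/
lemma bridge_of_notMem {v₀ w l : V} (c : G.Walk v₀ v₀)
    (huniq : ∀ (u : V) (c' : G.Walk u u), c'.IsCycle →
      c'.support.toFinset = c.support.toFinset)
    (hl : l ∉ c.support) (h : G.Adj w l) : ∀ p : G.Walk w l, s(w, l) ∈ p.edges := by
  rw [← isBridge_iff_forall_walk_mem_edges, isBridge_iff_forall_cycle_notMem h]
  intro u p hp he
  apply hl
  have := huniq u p hp
  rw [← List.mem_toFinset, ← this, List.mem_toFinset]
  exact p.snd_mem_support_of_mem_edges he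

lemma walk_in_support {v₀ u v : V} (c : G.Walk v₀ v₀)
    (hu : u ∈ c.support) (hv : v ∈ c.support) :
    ∃ p : G.Walk u v, ∀ x ∈ p.support, x ∈ c.support := by
  refine ⟨(c.dropUntil u hu).append (c.takeUntil v hv), fun x hx => ?_⟩
  rw [Walk.mem_support_append_iff] at hx
  rcases hx with hx | hx
  · exact c.support_dropUntil_subset_support hu hx
  · exact c.support_takeUntil_subset_support hv hx

/-- Paths of `G` between cycle vertices live in the cycle. -/
lemma path_in_cycle {v₀ : V} (c : G.Walk v₀ v₀) (hc : c.IsCycle)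
    (huniq : ∀ (u : V) (c' : G.Walk u u), c'.IsCycle →
      c'.support.toFinset = c.support.toFinset) {u v : V} (p : G.Walk u v) (hp : p.IsPath)
    (hu : u ∈ c.toSubgraph.verts) (hv : v ∈ c.toSubgraph.verts) :
    ∃ q : c.toSubgraph.coe.Walk ⟨u, hu⟩ ⟨v, hv⟩, q.length = p.length := by
  induction p with
  | nil => exact ⟨Walk.nil, rfl⟩
  | @cons a b d h p ih =>
    rw [Walk.cons_isPath_iff] at hp
    have hu' := c.mem_verts_toSubgraph.1 hu
    have hv' := c.mem_verts_toSubgraph.1 hv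
    by_cases hb : b ∈ c.support
    · obtain ⟨q, hq⟩ := ih hp.1 (c.mem_verts_toSubgraph.2 hb) hv
      have had : c.toSubgraph.coe.Adj ⟨a, hu⟩ ⟨b, c.mem_verts_toSubgraph.2 hb⟩ :=
        chordless c hc huniq hu' hb h
      exact ⟨Walk.cons had q, by simp [hq]⟩
    · exfalso
      obtain ⟨r, hr⟩ := walk_in_support c hu' hv'
      have := bridge_of_notMem c huniq hb h (r.append p.reverse)
      rw [Walk.edges_append, List.mem_append, Walk.edges_reverse, List.mem_reverse] at this
      rcases this with h1 | h1
      · exact hb (hr _ (r.snd_mem_support_of_mem_edges h1))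
      · exact hp.2 (p.fst_mem_support_of_mem_edges h1)

lemma dist_cycle (hG : G.Connected) {v₀ : V} (c : G.Walk v₀ v₀) (hc : c.IsCycle)
    (huniq : ∀ (u : V) (c' : G.Walk u u), c'.IsCycle →
      c'.support.toFinset = c.support.toFinset) (u v : c.toSubgraph.verts) :
    c.toSubgraph.coe.dist u v = G.dist u v := by
  obtain ⟨p, hp, hpl⟩ := hG.exists_path_of_dist (u : V) v
  obtain ⟨q, hq⟩ := path_in_cycle c hc huniq p hp u.2 v.2
  apply le_antisymm
  · rw [← hpl, ← hq]
    exact dist_le q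
  · obtain ⟨r, hr⟩ := (Walk.reachable q).exists_walk_length_eq_dist
    have := dist_le (r.map c.toSubgraph.hom)
    rw [Walk.length_map, hr] at this
    exact this

/-- Attaching a pendant vertex: distances. -/
lemma dist_pendant (hG : G.Connected) {S : Finset V} {w l u : V}
    (hbr : ∀ p : G.Walk w l, s(w, l) ∈ p.edges) (h : G.Adj w l) (hl : l ∉ S)
    (hS : ∃ p : G.Walk w u, ∀ x ∈ p.support, x ∈ S) :
    G.dist u l = G.dist u w + 1 := by
  obtain ⟨p, hp⟩ := hS
  obtain ⟨q, hq⟩ := hG.exists_walk_length_eq_dist u l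
  have := hbr (p.append q)
  rw [Walk.edges_append, List.mem_append] at this
  have hwl : G.dist w l = 1 := dist_eq_one_iff_adj.2 h
  apply le_antisymm
  · rw [← hwl]; exact hG.dist_triangle
  · rcases this with h1 | h1
    · exact absurd (hp _ (p.snd_mem_support_of_mem_edges h1)) hl
    · have hw := q.fst_mem_support_of_mem_edges h1
      have h5 := congrArg Walk.length (q.take_spec hw)
      rw [Walk.length_append] at h5
      have h6 := dist_le (q.takeUntil w hw)
      have h7 := dist_le (q.dropUntil w hw)
      omega

/-- The invariant of the construction. -/
structure GrowInv (G : SimpleGraph V) [DecidableRel G.Adj] (C B S W : Finset V) : Prop where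
  cyc : C ⊆ S
  conn : ∀ u ∈ S, ∀ v ∈ S, ∃ p : G.Walk u v, ∀ x ∈ p.support, x ∈ S
  sub : W ⊆ S
  two : ∀ w, ∃ x ∈ W, x ≠ w
  res : ∀ u ∈ S, ∀ v ∈ S, u ≠ v → ∃ x ∈ W, ∃ y ∈ W, doublyResolves G x y u v
  deg : ∀ x ∈ W, (G.neighborFinset x ∩ S).card ≤ if x ∈ B then 2 else 1

lemma GrowInv.step [DecidableRel G.Adj] (hG : G.Connected) {C B S W : Finset V} (hBC : B ⊆ C)
    (hI : GrowInv G C B S W)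
    {w l : V} (hw : w ∈ S) (hl : l ∉ S) (h : G.Adj w l)
    (hbr : ∀ p : G.Walk w l, s(w, l) ∈ p.edges) :
    GrowInv G C B (insert l S) (insert l (W.erase w)) := by
  have hd : ∀ u ∈ S, G.dist u l = G.dist u w + 1 := fun u hu =>
    dist_pendant hG hbr h hl (hI.conn w hw u hu)
  have hadj : ∀ u ∈ S, G.Adj u l → u = w := by
    intro u hu ha
    have h1 := hd u hu
    rw [dist_eq_one_iff_adj.2 ha] at h1
    exact hG.dist_eq_zero_iff.1 (by omega)
  have hlift : ∀ x ∈ W, ∃ x' ∈ insert l (W.erase w), ∀ u ∈ S, ∀ v ∈ S,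
      (G.dist u x : ℤ) - G.dist v x = G.dist u x' - G.dist v x' := by
    intro x hx
    by_cases hxw : x = w
    · refine ⟨l, by simp, fun u hu v hv => ?_⟩
      rw [hd u hu, hd v hv, hxw]; push_cast; ring
    · exact ⟨x, by simp [hx, hxw], fun _ _ _ _ => rfl⟩
  have hpair : ∀ v ∈ S, ∃ x ∈ insert l (W.erase w), ∃ y ∈ insert l (W.erase w),
      (G.dist l x : ℤ) - G.dist v x ≠ G.dist l y - G.dist v y := by
    intro v hv
    obtain ⟨x, hx, hxw⟩ := hI.two w
    refine ⟨l, by simp, x, by simp [hx, hxw], ?_⟩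
    have h1 := hd x (hI.sub hx)
    have h2 := hd v hv
    have h3 : G.dist v x ≤ G.dist v w + G.dist w x := hG.dist_triangle
    rw [dist_comm (u := x) (v := l), dist_comm (u := x) (v := w)] at h1
    rw [dist_self, h1, h2]
    push_cast
    intro h4
    omega
  refine ⟨hI.cyc.trans (Finset.subset_insert _ _), ?_, ?_, ?_, ?_, ?_⟩
  · have key : ∀ u ∈ insert l S, ∃ p : G.Walk u w, ∀ x ∈ p.support, x ∈ insert l S := by
      intro u hu
      rcases Finset.mem_insert.1 hu with rfl | hu
      · exact ⟨Walk.cons h.symm Walk.nil, by simp [hw]⟩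
      · obtain ⟨p, hp⟩ := hI.conn u hu w hw
        exact ⟨p, fun x hx => Finset.mem_insert_of_mem (hp x hx)⟩
    intro u hu v hv
    obtain ⟨p, hp⟩ := key u hu
    obtain ⟨q, hq⟩ := key v hv
    refine ⟨p.append q.reverse, fun x hx => ?_⟩
    rw [Walk.mem_support_append_iff, Walk.support_reverse, List.mem_reverse] at hx
    rcases hx with hx | hx
    · exact hp x hx
    · exact hq x hx
  · exact Finset.insert_subset_insert _ ((Finset.erase_subset _ _).trans hI.sub)
  · intro z
    obtain ⟨x, hx, hxw⟩ := hI.two w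
    by_cases hz : z = l
    · refine ⟨x, by simp [hx, hxw], ?_⟩
      rintro rfl
      exact hl (hz ▸ hI.sub hx)
    · exact ⟨l, by simp, fun h => hz h.symm⟩
  · intro u hu v hv huv
    rcases Finset.mem_insert.1 hu with rfl | hu
    · rcases Finset.mem_insert.1 hv with rfl | hv
      · exact absurd rfl huv
      · exact hpair v hv
    · rcases Finset.mem_insert.1 hv with rfl | hv
      · obtain ⟨x, hx, y, hy, h1⟩ := hpair u (by assumption)
        refine ⟨x, hx, y, hy, fun h2 => h1 ?_⟩
        linarith
      · obtain ⟨x, hx, y, hy, h1⟩ := hI.res u hu v hv huv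
        obtain ⟨x', hx', h2⟩ := hlift x hx
        obtain ⟨y', hy', h3⟩ := hlift y hy
        refine ⟨x', hx', y', hy', fun h4 => h1 ?_⟩
        rw [h2 u hu v hv, h3 u hu v hv, h4]
  · intro x hx
    rcases Finset.mem_insert.1 hx with rfl | hx
    · rw [if_neg (fun hb => hl (hI.cyc (hBC hb)))]
      have : G.neighborFinset x ∩ insert x S ⊆ {w} := by
        intro z hz
        simp only [Finset.mem_inter, mem_neighborFinset, Finset.mem_insert] at hz
        rcases hz with ⟨ha, rfl | hz⟩
        · exact absurd ha (G.loopless.irrefl _)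
        · simpa using hadj z hz ha.symm
      simpa using Finset.card_le_card this
    · obtain ⟨hxw, hxW⟩ := Finset.mem_erase.1 hx
      have : G.neighborFinset x ∩ insert l S ⊆ G.neighborFinset x ∩ S := by
        intro z hz
        simp only [Finset.mem_inter, mem_neighborFinset, Finset.mem_insert] at hz ⊢
        rcases hz with ⟨ha, rfl | hz⟩
        · exact absurd (hadj x (hI.sub hxW) ha) hxw
        · exact ⟨ha, hz⟩
      exact (Finset.card_le_card this).trans (hI.deg x hxW)

lemma GrowInv.grow [DecidableRel G.Adj] (hG : G.Connected) {C B : Finset V} (hBC : B ⊆ C)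
    (hC : C.Nonempty)
    (hbr : ∀ w l, l ∉ C → G.Adj w l → ∀ p : G.Walk w l, s(w, l) ∈ p.edges) (n : ℕ) :
    ∀ S W : Finset V, Sᶜ.card = n → GrowInv G C B S W → ∃ W', GrowInv G C B Finset.univ W' := by
  induction n with
  | zero =>
    intro S W hS hI
    rw [Finset.card_eq_zero, Finset.compl_eq_empty_iff] at hS
    exact ⟨W, hS ▸ hI⟩
  | succ n ih =>
    intro S W hS hI
    obtain ⟨z, hz⟩ : Sᶜ.Nonempty := by
      rw [← Finset.card_pos]; omega
    rw [Finset.mem_compl] at hz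
    obtain ⟨a, ha⟩ := hC
    obtain ⟨p⟩ := hG.preconnected a z
    obtain ⟨d, -, hd1, hd2⟩ := p.exists_boundary_dart (S : Set V) (hI.cyc ha) hz
    simp only [Finset.mem_coe] at hd1 hd2
    refine ih _ _ ?_ (hI.step hG hBC hd1 hd2 d.adj
      (hbr _ _ (fun h => hd2 (hI.cyc h)) d.adj))
    rw [Finset.compl_insert, Finset.card_erase_of_mem (by simpa using hd2), hS]
    rfl

lemma leaf_mem (hG : G.Connected) [DecidableRel G.Adj] {W : Set V}
    (hW : IsDoublyResolvingSet G W) {l : V} (hl : G.degree l = 1) : l ∈ W := by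
  by_contra hlW
  rw [degree, Finset.card_eq_one] at hl
  obtain ⟨w, hw⟩ := hl
  have hadj : ∀ x, G.Adj l x ↔ x = w := by
    intro x
    rw [← mem_neighborFinset, hw, Finset.mem_singleton]
  have hlw := (hadj w).2 rfl
  have key : ∀ x, x ≠ l → G.dist l x = G.dist w x + 1 := by
    intro x hx
    obtain ⟨p, hp⟩ := hG.exists_walk_length_eq_dist l x
    have h1 : G.dist l x ≤ G.dist l w + G.dist w x := hG.dist_triangle
    rw [dist_eq_one_iff_adj.2 hlw] at h1
    cases p with
    | nil => exact absurd rfl hx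
    | cons h q =>
      obtain rfl := (hadj _).1 h
      have := dist_le q
      simp only [Walk.length_cons] at hp
      omega
  obtain ⟨x, hx, y, hy, h⟩ := hW l w hlw.ne
  apply h
  rw [key x (fun e => hlW (e ▸ hx)), key y (fun e => hlW (e ▸ hy))]
  push_cast
  ring

end Helpers

/-- Let `G` be a connected unicyclic graph that is not a cycle, with unique cycle `c`.
If some doubly basis `B` of the cycle (as a graph in its own right) consists only of
vertices of degree at least `3` in `G`, then `ψ(G) = l(G)`, the number of leaves. -/
theorem stmt_15 {V : Type*} [Fintype V] [DecidableEq V] (G : SimpleGraph V)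
    [DecidableRel G.Adj] (hG : G.Connected)
    (v₀ : V) (c : G.Walk v₀ v₀) (hc : c.IsCycle)
    (huniq : ∀ (u : V) (c' : G.Walk u u), c'.IsCycle →
      c'.support.toFinset = c.support.toFinset)
    (hnotcycle : ∃ v : V, v ∉ c.support)
    (B : Finset ↑c.toSubgraph.verts)
    (hB : IsDoublyResolvingSet c.toSubgraph.coe ↑B)
    (hBmin : B.card = psi c.toSubgraph.coe)
    (hdeg : ∀ b ∈ B, 3 ≤ G.degree (b : V)) :
    psi G = (Finset.univ.filter fun v : V => G.degree v = 1).card := by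
  classical
  set L := Finset.univ.filter fun v : V => G.degree v = 1 with hL
  set C := c.support.toFinset with hCdef
  set B' : Finset V := B.map (Function.Embedding.subtype _) with hB'
  have hmem : ∀ x, x ∈ C ↔ x ∈ c.toSubgraph.verts := by
    intro x
    rw [hCdef, List.mem_toFinset, Walk.mem_verts_toSubgraph]
  have hBC : B' ⊆ C := by
    intro x hx
    rw [hB', Finset.mem_map] at hx
    obtain ⟨b, -, rfl⟩ := hx
    exact (hmem _).2 b.2
  have hv₀ : v₀ ∈ C := by simp [hCdef]
  have hres : ∀ u ∈ C, ∀ v ∈ C, u ≠ v → ∃ x ∈ B', ∃ y ∈ B', doublyResolves G x y u v := by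
    intro u hu v hv huv
    obtain ⟨x, hx, y, hy, h⟩ := hB ⟨u, (hmem u).1 hu⟩ ⟨v, (hmem v).1 hv⟩
      (fun h => huv (congrArg Subtype.val h))
    refine ⟨x, Finset.mem_map_of_mem _ hx, y, Finset.mem_map_of_mem _ hy, ?_⟩
    unfold doublyResolves at h ⊢
    simpa only [dist_cycle hG c hc huniq] using h
  have hI : GrowInv G C B' C B' := by
    refine ⟨subset_rfl, ?_, hBC, ?_, hres, ?_⟩
    · intro u hu v hv
      rw [hCdef, List.mem_toFinset] at hu hv
      obtain ⟨p, hp⟩ := walk_in_support c hu hv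
      exact ⟨p, fun x hx => List.mem_toFinset.2 (hp x hx)⟩
    · intro w
      have hs : c.snd ∈ C := by
        rw [hCdef, List.mem_toFinset]
        exact c.getVert_mem_support 1
      have hne : v₀ ≠ c.snd := (c.adj_snd hc.not_nil).ne
      obtain ⟨x, hx, y, hy, h⟩ := hres _ hv₀ _ hs hne
      by_cases hxw : x = w
      · refine ⟨y, hy, ?_⟩
        rintro rfl
        exact h (by rw [hxw])
      · exact ⟨x, hx, hxw⟩
    · intro x hx
      rw [if_pos hx]
      have hxc : x ∈ c.support := List.mem_toFinset.1 (hBC hx)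
      have h2 := hc.ncard_neighborSet_toSubgraph_eq_two hxc
      rw [← h2, ← Set.ncard_coe_finset]
      refine Set.ncard_le_ncard ?_ (Set.toFinite _)
      intro z hz
      simp only [Finset.coe_inter, Set.mem_inter_iff, Finset.mem_coe, mem_neighborFinset] at hz
      exact chordless c hc huniq hxc (List.mem_toFinset.1 hz.2) hz.1
  obtain ⟨W, hW⟩ := GrowInv.grow hG hBC ⟨v₀, hv₀⟩
    (fun w l hl h => bridge_of_notMem c huniq (fun h' => hl (List.mem_toFinset.2 h')) h)
    _ C B' rfl hI
  have hnt : Nontrivial V := ⟨v₀, c.snd, (c.adj_snd hc.not_nil).ne⟩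
  have hWL : W ⊆ L := by
    intro x hx
    have h1 := hW.deg x hx
    rw [Finset.inter_univ, card_neighborFinset_eq_degree] at h1
    have hpos : 0 < G.degree x := hG.preconnected.degree_pos_of_nontrivial x
    split_ifs at h1 with hxB
    · rw [hB', Finset.mem_map] at hxB
      obtain ⟨b, hb, rfl⟩ := hxB
      have := hdeg b hb
      exact absurd (this.trans h1) (by norm_num)
    · rw [hL, Finset.mem_filter]
      exact ⟨Finset.mem_univ _, by omega⟩
  have hLres : IsDoublyResolvingSet G (L : Set V) := by
    intro u v huv
    obtain ⟨x, hx, y, hy, h⟩ := hW.res u (Finset.mem_univ _) v (Finset.mem_univ _) huv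
    exact ⟨x, hWL hx, y, hWL hy, h⟩
  have hLin : L.card ∈ {k | ∃ W : Finset V, W.card = k ∧ IsDoublyResolvingSet G ↑W} :=
    ⟨L, rfl, hLres⟩
  apply le_antisymm
  · exact Nat.sInf_le hLin
  · obtain ⟨W₁, hW₁, hr⟩ := Nat.sInf_mem ⟨_, hLin⟩
    unfold psi
    rw [← hW₁]
    apply Finset.card_le_card
    intro l hl
    rw [hL, Finset.mem_filter] at hl
    exact leaf_mem hG hr hl.2
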